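/- Suppose in addition that X has nondecreasing paths (X is an ascending subordinator) and that there is a function φ : [0, ∞) → [0, ∞) with E[e^{−λ X_t}] = e^{−t φ(λ)} for all t, λ ≥ 0. Then for every α > 0, β ≥ 0 and q > 0 with q ≠ β, ∫_0^∞ e^{−q x} E[e^{−α τ_x^+ − β (X_{τ_x^+} − x)} 1_{{τ_x^+ < ∞}}] dx = (φ(q) − φ(β)) / ((q − β)(α + φ(q))). -/

import Mathlib

open MeasureTheory ProbabilityTheory Set Filter
open scoped ENNReal NNReal Classical

noncomputable section

namespace AKLevy

variable {Ω : Type*}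

/-- Running supremum `X̄_t = sup_{0 ≤ s ≤ t} X_s` of a process. -/
def runSup (X : ℝ → Ω → ℝ) (t : ℝ) (ω : Ω) : ℝ :=
  sSup ((fun s => X s ω) '' Set.Icc 0 t)

/-- Running infimum `X̲_t = inf_{0 ≤ s ≤ t} X_s` of a process. -/
def runInf (X : ℝ → Ω → ℝ) (t : ℝ) (ω : Ω) : ℝ :=
  sInf ((fun s => X s ω) '' Set.Icc 0 t)

/-- All-time supremum `X̄_∞ = sup_{t ≥ 0} X_t`. -/
def supAll (X : ℝ → Ω → ℝ) (ω : Ω) : ℝ :=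
  sSup ((fun s => X s ω) '' Set.Ici 0)

/-- All-time infimum `X̲_∞ = inf_{t ≥ 0} X_t`. -/
def infAll (X : ℝ → Ω → ℝ) (ω : Ω) : ℝ :=
  sInf ((fun s => X s ω) '' Set.Ici 0)

/-- `X` is a real-valued Lévy process with respect to the filtration `ℱ`,
on a filtered probability space satisfying the usual conditions. -/
structure IsLevy [m0 : MeasurableSpace Ω] (P : Measure Ω) (ℱ : Filtration ℝ m0)
    (X : ℝ → Ω → ℝ) : Prop where
  isProb : IsProbabilityMeasure P
  adapted : ∀ t : ℝ, 0 ≤ t → StronglyMeasurable[ℱ t] (X t)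
  zero : ∀ᵐ ω ∂P, X 0 ω = 0
  rightCont : ∀ ω, ∀ t : ℝ, 0 ≤ t → ContinuousWithinAt (fun s => X s ω) (Set.Ici t) t
  leftLim : ∀ ω, ∀ t : ℝ, 0 < t →
    ∃ l : ℝ, Tendsto (fun s => X s ω) (nhdsWithin t (Set.Iio t)) (nhds l)
  indepIncrements : ∀ s t : ℝ, 0 ≤ s → s ≤ t →
    Indep (MeasurableSpace.comap (fun ω => X t ω - X s ω) inferInstance) (ℱ s) P
  stationary : ∀ s t : ℝ, 0 ≤ s → s ≤ t →
    Measure.map (fun ω => X t ω - X s ω) P = Measure.map (X (t - s)) P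
  filtRightCont : ∀ t : ℝ, (ℱ t : MeasurableSpace Ω) = ⨅ s ∈ Set.Ioi t, (ℱ s : MeasurableSpace Ω)
  complete : ∀ N : Set Ω, MeasurableSet N → P N = 0 → MeasurableSet[ℱ 0] N

/-- `τ_x^+ < ∞`: the process passes strictly above level `x` at some nonnegative time. -/
def hitsAbove (X : ℝ → Ω → ℝ) (x : ℝ) (ω : Ω) : Prop := ∃ t, 0 ≤ t ∧ x < X t ω

/-- First passage time above `x`:  `τ_x^+ = inf {t ≥ 0 : X_t > x}` (junk value if never). -/
def tauAbove (X : ℝ → Ω → ℝ) (x : ℝ) (ω : Ω) : ℝ := sInf {t : ℝ | 0 ≤ t ∧ x < X t ω}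

/-- `τ_x^- < ∞`: the process passes strictly below level `x` at some nonnegative time. -/
def hitsBelow (X : ℝ → Ω → ℝ) (x : ℝ) (ω : Ω) : Prop := ∃ t, 0 ≤ t ∧ X t ω < x

/-- First passage time below `x`:  `τ_x^- = inf {t ≥ 0 : X_t < x}` (junk value if never). -/
def tauBelow (X : ℝ → Ω → ℝ) (x : ℝ) (ω : Ω) : ℝ := sInf {t : ℝ | 0 ≤ t ∧ X t ω < x}

/-- The `[0,∞]`-valued first passage time `σ_x = inf { t ≥ 0 : x + X_t < y }`, with `inf ∅ = ∞`. -/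
def hitBelowE (X : ℝ → Ω → ℝ) (y x : ℝ) (ω : Ω) : ℝ≥0∞ :=
  if ∃ t, 0 ≤ t ∧ x + X t ω < y then ENNReal.ofReal (sInf {t : ℝ | 0 ≤ t ∧ x + X t ω < y})
  else ∞

/-- The stopped clock `t ∧ σ_x` (real-valued), where `σ_x = inf{ t ≥ 0 : x + X_t < y}`. -/
def stoppedClock (X : ℝ → Ω → ℝ) (y x : ℝ) (t : ℝ) (ω : Ω) : ℝ :=
  (min (ENNReal.ofReal t) (hitBelowE X y x ω)).toReal

/-- A `[0,∞]`-valued stopping time of the filtration `ℱ`. -/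
def IsStopTime [m0 : MeasurableSpace Ω] (ℱ : Filtration ℝ m0) (τ : Ω → ℝ≥0∞) : Prop :=
  ∀ t : ℝ, 0 ≤ t → MeasurableSet[ℱ t] {ω | τ ω ≤ ENNReal.ofReal t}

/-- Discounted payoff `e^{-rτ} G(x + X_τ)` at a `[0,∞]`-valued time `τ`, set to `0` on `{τ = ∞}`. -/
def stopPayoff (X : ℝ → Ω → ℝ) (r x : ℝ) (G : ℝ → ℝ) (τ : Ω → ℝ≥0∞) (ω : Ω) : ℝ :=
  if τ ω ≠ ∞ then Real.exp (-(r * (τ ω).toReal)) * G (x + X ((τ ω).toReal) ω) else 0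

/-- Discounted American put payoff `e^{-rτ}(K - e^{x + X_τ})^+ 1_{τ < ∞}`. -/
def putPayoff (X : ℝ → Ω → ℝ) (r K x : ℝ) (τ : Ω → ℝ≥0∞) (ω : Ω) : ℝ :=
  stopPayoff X r x (fun z => max (K - Real.exp z) 0) τ ω

/-- Value function `v(x) = sup_τ E[e^{-rτ}(K - e^{x+X_τ})^+ 1_{τ<∞}]`, the supremum
being over all `[0,∞]`-valued stopping times of `ℱ`. -/
def putValue [m0 : MeasurableSpace Ω] (P : Measure Ω) (ℱ : Filtration ℝ m0)
    (X : ℝ → Ω → ℝ) (r K x : ℝ) : ℝ :=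
  ⨆ τ : {τ : Ω → ℝ≥0∞ // IsStopTime ℱ τ}, ∫ ω, putPayoff X r K x τ.1 ω ∂P

/-- `m = E[e^{X̲_{e_r}}]`, where `e_r` is an independent exponential time of rate `r > 0`,
and `e_0 = ∞`. -/
def mInf [m0 : MeasurableSpace Ω] (P : Measure Ω) (X : ℝ → Ω → ℝ) (r : ℝ) : ℝ :=
  if 0 < r then
    ∫ t in Set.Ioi (0 : ℝ), r * Real.exp (-(r * t)) * (∫ ω, Real.exp (runInf X t ω) ∂P)
  else ∫ ω, Real.exp (infAll X ω) ∂P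

/-- `P(X̲_{e_r} = 0)`, where `e_r` is an independent exponential time of rate `r > 0`,
and `e_0 = ∞`. -/
def atomZeroProb [m0 : MeasurableSpace Ω] (P : Measure Ω) (X : ℝ → Ω → ℝ) (r : ℝ) : ℝ :=
  if 0 < r then
    ∫ t in Set.Ioi (0 : ℝ), r * Real.exp (-(r * t)) * (P {ω | runInf X t ω = 0}).toReal
  else (P {ω | infAll X ω = 0}).toReal

/-- The event `{τ_0^- = 0}`: `0` is (pathwise) immediately reached from below, i.e.
`inf{t ≥ 0 : X_t < 0} = 0`. -/
def regularBelow (X : ℝ → Ω → ℝ) : Set Ω :=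
  {ω | ∀ ε > (0 : ℝ), ∃ t, 0 ≤ t ∧ t < ε ∧ X t ω < 0}

/-- `E[e^{-γ X̄_{e_α}}] = ∫_0^∞ α e^{-α t} E[e^{-γ X̄_t}] dt`. -/
def expSupLT [m0 : MeasurableSpace Ω] (P : Measure Ω) (X : ℝ → Ω → ℝ) (α γ : ℝ) : ℝ :=
  ∫ t in Set.Ioi (0 : ℝ), α * Real.exp (-(α * t)) * (∫ ω, Real.exp (-(γ * runSup X t ω)) ∂P)

/-- The function `h_{α,β}(x) = E[e^{-α σ_x + β (x + X_{σ_x})} 1_{σ_x < ∞}]`, where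
`σ_x = inf{t ≥ 0 : x + X_t < 0}`. -/
def hAB [m0 : MeasurableSpace Ω] (P : Measure Ω) (X : ℝ → Ω → ℝ) (α β : ℝ) (z : ℝ) : ℝ :=
  ∫ ω, (if hitsBelow X (-z) ω then
      Real.exp (-(α * tauBelow X (-z) ω) + β * (z + X (tauBelow X (-z) ω) ω)) else 0) ∂P

/-- `v_y(x) = E[e^{-r σ_x} (K - e^{x + X_{σ_x}})^+ 1_{σ_x<∞}]` where
`σ_x = inf{t ≥ 0 : x + X_t < y}`. -/
def vy [m0 : MeasurableSpace Ω] (P : Measure Ω) (X : ℝ → Ω → ℝ) (r K y : ℝ) (z : ℝ) : ℝ :=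
  ∫ ω, putPayoff X r K z (hitBelowE X y z) ω ∂P

/-- The process `f` (indexed by `t ≥ 0`) is a martingale with respect to `ℱ` and `P`. -/
def MartOn [m0 : MeasurableSpace Ω] (P : Measure Ω) (ℱ : Filtration ℝ m0)
    (f : ℝ → Ω → ℝ) : Prop :=
  (∀ t : ℝ, 0 ≤ t → StronglyMeasurable[ℱ t] (f t)) ∧
  (∀ t : ℝ, 0 ≤ t → Integrable (f t) P) ∧
  ∀ s t : ℝ, 0 ≤ s → s ≤ t → P[f t|ℱ s] =ᵐ[P] f s

/-- The process `f` (indexed by `t ≥ 0`) is a supermartingale w.r.t. `ℱ` and `P`. -/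
def SupermartOn [m0 : MeasurableSpace Ω] (P : Measure Ω) (ℱ : Filtration ℝ m0)
    (f : ℝ → Ω → ℝ) : Prop :=
  (∀ t : ℝ, 0 ≤ t → StronglyMeasurable[ℱ t] (f t)) ∧
  (∀ t : ℝ, 0 ≤ t → Integrable (f t) P) ∧
  ∀ s t : ℝ, 0 ≤ s → s ≤ t → P[f t|ℱ s] ≤ᵐ[P] f s

/-- The discounted integrand on the event that level `x` is first passed, along the grid `hℕ`,
at time `(k + 1) h`. -/
def gridTerm (X : ℝ → Ω → ℝ) (α β q h : ℝ) (k : ℕ) (p : ℝ × Ω) : ℝ :=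
  if X (k * h) p.2 ≤ p.1 ∧ p.1 < X ((k + 1) * h) p.2 then
    Real.exp (-(q * p.1)) * Real.exp (-(α * ((k + 1) * h)) - β * (X ((k + 1) * h) p.2 - p.1))
  else 0

/-- The discounted payoff at first passage above `x`, weighted by `e^{-qx}`. -/
def passagePayoff (X : ℝ → Ω → ℝ) (α β q : ℝ) (p : ℝ × Ω) : ℝ :=
  Real.exp (-(q * p.1)) * (if hitsAbove X p.1 p.2 then
    Real.exp (-(α * tauAbove X p.1 p.2) - β * (X (tauAbove X p.1 p.2) p.2 - p.1)) else 0)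

lemma gridTerm_nonneg (X : ℝ → Ω → ℝ) (α β q h : ℝ) (k : ℕ) (p : ℝ × Ω) :
    0 ≤ gridTerm X α β q h k p := by
  unfold gridTerm; split_ifs <;> positivity

lemma gridTerm_le (X : ℝ → Ω → ℝ) (α q h : ℝ) {β : ℝ} (hβ : 0 ≤ β) (k : ℕ) (p : ℝ × Ω) :
    gridTerm X α β q h k p ≤ Real.exp (-(α * ((k + 1) * h))) * Real.exp (-(q * p.1)) := by
  unfold gridTerm
  split_ifs with hp
  · rw [mul_comm]
    gcongr
    nlinarith [hp.2]
  · positivity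

lemma measurable_gridTerm [MeasurableSpace Ω] {X : ℝ → Ω → ℝ}
    (hX : ∀ t, 0 ≤ t → Measurable (X t)) (α β q : ℝ) {h : ℝ} (hh : 0 ≤ h) (k : ℕ) :
    Measurable (gridTerm X α β q h k) := by
  have h1 : Measurable fun p : ℝ × Ω => X (k * h) p.2 :=
    (hX _ (by positivity)).comp measurable_snd
  have h2 : Measurable fun p : ℝ × Ω => X ((k + 1) * h) p.2 :=
    (hX _ (by positivity)).comp measurable_snd
  have h3 : Measurable fun p : ℝ × Ω => Real.exp (-(q * p.1)) *
      Real.exp (-(α * ((k + 1) * h)) - β * (X ((k + 1) * h) p.2 - p.1)) :=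
    (measurable_fst.const_mul q).neg.exp.mul
      (((h2.sub measurable_fst).const_mul β).const_sub _).exp
  exact h3.ite ((measurableSet_le h1 measurable_fst).inter (measurableSet_lt measurable_fst h2))
    measurable_const

/-- A nondecreasing path passes level `x` between two consecutive points of the grid `hℕ`, and the
upper one exceeds the passage time by at most `h`. -/
lemma exists_grid_passage {f : ℝ → ℝ} (hf : MonotoneOn f (Ici 0)) {x h : ℝ} (hh : 0 < h)
    (h0 : f 0 ≤ x) (hit : ∃ t, 0 ≤ t ∧ x < f t) :
    ∃ k : ℕ, f (k * h) ≤ x ∧ x < f ((k + 1) * h) ∧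
      sInf {t | 0 ≤ t ∧ x < f t} ≤ (k + 1) * h ∧
      (k + 1) * h ≤ sInf {t | 0 ≤ t ∧ x < f t} + h := by
  obtain ⟨t, ht, hxt⟩ := hit
  have hex : ∃ n : ℕ, x < f (n * h) := by
    obtain ⟨n, hn⟩ := exists_nat_ge (t / h)
    have hn' : t ≤ n * h := (div_le_iff₀ hh).mp hn
    exact ⟨n, hxt.trans_le (hf ht (ht.trans hn') hn')⟩
  have hpos : Nat.find hex ≠ 0 := fun h1 => by
    have := Nat.find_spec hex
    rw [h1] at this
    simp only [Nat.cast_zero, zero_mul] at this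
    exact absurd this h0.not_gt
  obtain ⟨k, hk⟩ := Nat.exists_eq_succ_of_ne_zero hpos
  have hle : f (k * h) ≤ x := not_lt.mp (Nat.find_min hex (m := k) (by omega))
  have hlt : x < f ((k + 1) * h) := by
    have := Nat.find_spec hex
    rw [hk] at this
    simpa using this
  refine ⟨k, hle, hlt, csInf_le ⟨0, fun s hs => hs.1⟩ ⟨by positivity, hlt⟩, ?_⟩
  have : k * h ≤ sInf {t | 0 ≤ t ∧ x < f t} := by
    refine le_csInf ⟨t, ht, hxt⟩ fun s hs => ?_
    by_contra hs'
    exact (hs.2.trans_le (hf hs.1 (by simp; positivity) (not_le.mp hs').le)).not_ge hle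
  linarith

lemma tsum_gridTerm {X : ℝ → Ω → ℝ} {ω : Ω} (hmono : MonotoneOn (fun s => X s ω) (Ici 0))
    (α β q : ℝ) {h x : ℝ} (hh : 0 < h) {k : ℕ} (h1 : X (k * h) ω ≤ x)
    (h2 : x < X ((k + 1) * h) ω) :
    ∑' j, gridTerm X α β q h j (x, ω) =
      Real.exp (-(q * x)) * Real.exp (-(α * ((k + 1) * h)) - β * (X ((k + 1) * h) ω - x)) := by
  have key : ∀ {i j : ℕ}, i < j → x < X ((i + 1) * h) ω → X (j * h) ω ≤ x → False := by
    intro i j hij hi hj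
    have hij' : (i + 1 : ℝ) ≤ j := by exact_mod_cast hij
    have hm := hmono (a := (i + 1) * h) (by simp; positivity) (b := j * h) (by simp; positivity)
      (by gcongr)
    simp only at hm
    linarith
  rw [tsum_eq_single k]
  · exact if_pos ⟨h1, h2⟩
  · intro j hj
    refine if_neg fun hp => ?_
    rcases lt_or_gt_of_ne hj with hjk | hjk
    · exact key hjk hp.2 h1
    · exact key hjk h2 hp.1

/-- On a path started below `x`, the grid approximations converge to the passage payoff. -/
lemma tendsto_tsum_gridTerm {X : ℝ → Ω → ℝ} {ω : Ω}
    (hmono : MonotoneOn (fun s => X s ω) (Ici 0))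
    (hright : ∀ t : ℝ, 0 ≤ t → ContinuousWithinAt (fun s => X s ω) (Ici t) t)
    (α β q : ℝ) {x : ℝ} (h0 : X 0 ω ≤ x) {h : ℕ → ℝ} (hh : ∀ n, 0 < h n)
    (hlim : Tendsto h atTop (nhds 0)) :
    Tendsto (fun n => ∑' k, gridTerm X α β q (h n) k (x, ω)) atTop
      (nhds (passagePayoff X α β q (x, ω))) := by
  by_cases hit : hitsAbove X x ω
  · choose k hk1 hk2 hk3 hk4 using fun n => exists_grid_passage hmono (hh n) h0 hit
    change ∀ n, tauAbove X x ω ≤ _ at hk3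
    change ∀ n, _ ≤ tauAbove X x ω + _ at hk4
    have hτ : 0 ≤ tauAbove X x ω := Real.sInf_nonneg fun t ht => ht.1
    have hT : Tendsto (fun n => ((k n : ℝ) + 1) * h n) atTop (nhds (tauAbove X x ω)) :=
      tendsto_of_tendsto_of_tendsto_of_le_of_le tendsto_const_nhds
        (by simpa using hlim.const_add (tauAbove X x ω)) hk3 hk4
    have hXT : Tendsto (fun n => X (((k n : ℝ) + 1) * h n) ω) atTop
        (nhds (X (tauAbove X x ω) ω)) :=
      (hright _ hτ).tendsto.comp
        (tendsto_nhdsWithin_iff.mpr ⟨hT, Eventually.of_forall hk3⟩)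
    simp_rw [fun n => tsum_gridTerm hmono α β q (hh n) (hk1 n) (hk2 n)]
    simp only [passagePayoff, if_pos hit]
    exact ((Real.continuous_exp.tendsto _).comp
      (((hT.const_mul α).neg).sub ((hXT.sub_const x).const_mul β))).const_mul _
  · have hz : ∀ n k, gridTerm X α β q (h n) k (x, ω) = 0 := fun n k =>
      if_neg fun hp => hit ⟨_, mul_nonneg (by positivity) (hh n).le, hp.2⟩
    simp [hz, passagePayoff, hit]

lemma norm_tsum_gridTerm_le {X : ℝ → Ω → ℝ} {ω : Ω}
    (hmono : MonotoneOn (fun s => X s ω) (Ici 0)) {α β q x h : ℝ} (hα : 0 ≤ α) (hβ : 0 ≤ β)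
    (hh : 0 < h) (h0 : X 0 ω ≤ x) :
    ‖∑' k, gridTerm X α β q h k (x, ω)‖ ≤ Real.exp (-(q * x)) := by
  by_cases hit : hitsAbove X x ω
  · obtain ⟨k, hk1, hk2, -⟩ := exists_grid_passage hmono hh h0 hit
    rw [tsum_gridTerm hmono α β q hh hk1 hk2, Real.norm_of_nonneg (by positivity)]
    refine mul_le_of_le_one_right (by positivity) (Real.exp_le_one_iff.mpr ?_)
    have h1 : 0 ≤ α * ((k + 1) * h) := by positivity
    have h2 : 0 ≤ β * (X ((k + 1) * h) ω - x) := mul_nonneg hβ (by linarith)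
    linarith
  · have hz : ∀ k, gridTerm X α β q h k (x, ω) = 0 := fun k =>
      if_neg fun hp => hit ⟨_, by positivity, hp.2⟩
    simp only [hz, tsum_zero, norm_zero]
    positivity

/-- Integral over the level of one grid term. -/
lemma integral_gridTerm_level {X : ℝ → Ω → ℝ} {ω : Ω}
    (hmono : MonotoneOn (fun s => X s ω) (Ici 0)) (h0 : X 0 ω = 0) (α : ℝ) {β q h : ℝ}
    (hqβ : q ≠ β) (hh : 0 ≤ h) (k : ℕ) :
    ∫ x in Ioi (0 : ℝ), gridTerm X α β q h k (x, ω) =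
      Real.exp (-(α * ((k + 1) * h))) / (β - q) * (Real.exp (-(q * X ((k + 1) * h) ω)) -
        Real.exp (-(q * X (k * h) ω)) *
          Real.exp (-(β * (X ((k + 1) * h) ω - X (k * h) ω)))) := by
  set a := X (k * h) ω with ha
  set b := X ((k + 1) * h) ω with hb
  have ha0 : 0 ≤ a := by
    rw [← h0]
    exact hmono (by simp) (by simp; positivity) (by positivity)
  have hab : a ≤ b := hmono (by simp; positivity) (by simp; positivity) (by gcongr; linarith)
  have hne : β - q ≠ 0 := sub_ne_zero.mpr hqβ.symm
  have hterm : ∀ x, gridTerm X α β q h k (x, ω) = (Ico a b).indicator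
      (fun x => Real.exp (-(α * ((k + 1) * h)) - β * b) * Real.exp ((β - q) * x)) x := by
    intro x
    simp only [gridTerm, indicator, mem_Ico, ← ha, ← hb]
    refine if_congr Iff.rfl ?_ rfl
    rw [← Real.exp_add, ← Real.exp_add]
    ring_nf
  have hset : (Ioi (0 : ℝ) ∩ Ico a b : Set ℝ) =ᵐ[volume] Ioc a b := by
    have h1 : (Ioi (0 : ℝ) : Set ℝ) =ᵐ[volume] Ici 0 := Ioi_ae_eq_Ici
    have h2 : (Ici (0 : ℝ) ∩ Ico a b : Set ℝ) = Ico a b :=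
      inter_eq_right.mpr fun x hx => ha0.trans hx.1
    have h3 := ae_eq_set_inter h1 (ae_eq_refl (Ico a b) : Ico a b =ᵐ[volume] Ico a b)
    rw [h2] at h3
    exact h3.trans Ico_ae_eq_Ioc
  simp_rw [hterm]
  rw [setIntegral_indicator measurableSet_Ico, setIntegral_congr_set hset,
    ← intervalIntegral.integral_of_le hab, intervalIntegral.integral_const_mul,
    intervalIntegral.integral_comp_mul_left (fun x => Real.exp x) hne, integral_exp, smul_eq_mul,
    sub_eq_add_neg (-(α * _)), Real.exp_add,
    show -(q * b) = -(β * b) + (β - q) * b by ring,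
    show Real.exp (-(q * a)) * Real.exp (-(β * (b - a))) =
      Real.exp (-(β * b)) * Real.exp ((β - q) * a) by rw [← Real.exp_add, ← Real.exp_add]; ring_nf,
    Real.exp_add, div_eq_mul_inv]
  ring

section Levy

variable [m0 : MeasurableSpace Ω] {P : Measure Ω} {ℱ : Filtration ℝ m0} {X : ℝ → Ω → ℝ}
  {φ : ℝ → ℝ}

lemma IsLevy.measurable (hX : IsLevy P ℱ X) {t : ℝ} (ht : 0 ≤ t) : Measurable (X t) :=
  ((hX.adapted t ht).mono (ℱ.le t)).measurable

/-- Laplace transform of a value and a subsequent increment, from independence and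
stationarity. -/
lemma IsLevy.integral_exp_mul_exp_increment (hX : IsLevy P ℱ X)
    (hφ : ∀ t l : ℝ, 0 ≤ t → 0 ≤ l →
      (∫ ω, Real.exp (-(l * X t ω)) ∂P) = Real.exp (-(t * φ l)))
    {q β s t : ℝ} (hq : 0 ≤ q) (hβ : 0 ≤ β) (hs : 0 ≤ s) (hst : s ≤ t) :
    ∫ ω, Real.exp (-(q * X s ω)) * Real.exp (-(β * (X t ω - X s ω))) ∂P =
      Real.exp (-(s * φ q)) * Real.exp (-((t - s) * φ β)) := by
  have hms := hX.measurable hs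
  have hmt := hX.measurable (hs.trans hst)
  have hind : IndepFun (X s) (fun ω => X t ω - X s ω) P := by
    rw [IndepFun_iff_Indep]
    exact indep_of_indep_of_le_left (hX.indepIncrements s t hs hst).symm
      (hX.adapted s hs).measurable.comap_le
  rw [hind.integral_fun_comp_mul_comp (f := fun y => Real.exp (-(q * y)))
    (g := fun y => Real.exp (-(β * y))) hms.aemeasurable (hmt.sub hms).aemeasurable
    (by fun_prop) (by fun_prop), hφ s q hs hq]
  congr 1
  rw [← hφ (t - s) β (sub_nonneg.mpr hst) hβ,
    ← integral_map (φ := fun ω => X t ω - X s ω) (f := fun y => Real.exp (-(β * y)))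
      (hmt.sub hms).aemeasurable (by fun_prop), hX.stationary s t hs hst,
    integral_map (hX.measurable (sub_nonneg.mpr hst)).aemeasurable (by fun_prop)]

lemma integrable_exp_neg_of_laplace (hφ : ∀ t l : ℝ, 0 ≤ t → 0 ≤ l →
      (∫ ω, Real.exp (-(l * X t ω)) ∂P) = Real.exp (-(t * φ l)))
    {t l : ℝ} (ht : 0 ≤ t) (hl : 0 ≤ l) : Integrable (fun ω => Real.exp (-(l * X t ω))) P :=
  not_imp_comm.mp integral_undef (by rw [hφ t l ht hl]; positivity)

lemma integrable_exp_neg_fst [IsProbabilityMeasure P] {q : ℝ} (hq : 0 < q) :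
    Integrable (fun p : ℝ × Ω => Real.exp (-(q * p.1)))
      ((volume.restrict (Ioi (0 : ℝ))).prod P) := by
  have h1 : Integrable (fun x : ℝ => Real.exp (-(q * x))) (volume.restrict (Ioi (0 : ℝ))) := by
    simpa [IntegrableOn, neg_mul] using exp_neg_integrableOn_Ioi 0 hq
  exact h1.comp_fst P

lemma IsLevy.integrable_gridTerm (hX : IsLevy P ℱ X) (α : ℝ) {β q h : ℝ} (hβ : 0 ≤ β)
    (hq : 0 < q) (hh : 0 ≤ h) (k : ℕ) :
    Integrable (gridTerm X α β q h k) ((volume.restrict (Ioi (0 : ℝ))).prod P) := by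
  have := hX.isProb
  refine ((integrable_exp_neg_fst hq).const_mul (Real.exp (-(α * ((k + 1) * h))))).mono'
    (measurable_gridTerm (fun t => hX.measurable) α β q hh k).aestronglyMeasurable
    (Eventually.of_forall fun p => ?_)
  rw [Real.norm_of_nonneg (gridTerm_nonneg ..)]
  exact gridTerm_le X α q h hβ k p

lemma IsLevy.integral_gridTerm (hX : IsLevy P ℱ X)
    (hmono : ∀ ω, MonotoneOn (fun s => X s ω) (Ici 0))
    (hφ : ∀ t l : ℝ, 0 ≤ t → 0 ≤ l →
      (∫ ω, Real.exp (-(l * X t ω)) ∂P) = Real.exp (-(t * φ l)))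
    (α : ℝ) {β q h : ℝ} (hβ : 0 ≤ β) (hq : 0 < q) (hqβ : q ≠ β) (hh : 0 ≤ h) (k : ℕ) :
    ∫ p, gridTerm X α β q h k p ∂((volume.restrict (Ioi (0 : ℝ))).prod P) =
      Real.exp (-(α * h)) / (β - q) * (Real.exp (-(h * φ q)) - Real.exp (-(h * φ β))) *
        Real.exp (-(h * (α + φ q))) ^ k := by
  have := hX.isProb
  have hk : (0 : ℝ) ≤ k * h := by positivity
  have hk' : (k * h : ℝ) ≤ (k + 1) * h := by linarith
  rw [integral_prod_symm _ (hX.integrable_gridTerm α hβ hq hh k)]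
  have hae : ∀ᵐ ω ∂P, ∫ x in Ioi (0 : ℝ), gridTerm X α β q h k (x, ω) = _ :=
    hX.zero.mono fun ω h0 => integral_gridTerm_level (hmono ω) h0 α hqβ hh k
  have hint : Integrable (fun ω => Real.exp (-(q * X (k * h) ω)) *
      Real.exp (-(β * (X ((k + 1) * h) ω - X (k * h) ω)))) P := by
    refine not_imp_comm.mp integral_undef ?_
    rw [hX.integral_exp_mul_exp_increment hφ hq.le hβ hk hk']
    positivity
  rw [integral_congr_ae hae, integral_const_mul,
    integral_sub (integrable_exp_neg_of_laplace hφ (hk.trans hk') hq.le) hint,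
    hX.integral_exp_mul_exp_increment hφ hq.le hβ hk hk', hφ _ _ (hk.trans hk') hq.le,
    ← Real.exp_nat_mul,
    show -(α * ((k + 1) * h)) = -(α * h) + -(α * (k * h)) by ring,
    show -((k + 1) * h * φ q) = -(k * h * φ q) + -(h * φ q) by ring,
    show (k + 1) * h - k * h = h by ring,
    show (k : ℝ) * -(h * (α + φ q)) = -(α * (k * h)) + -(k * h * φ q) by ring]
  simp only [Real.exp_add]
  ring

lemma IsLevy.integral_tsum_gridTerm (hX : IsLevy P ℱ X)
    (hmono : ∀ ω, MonotoneOn (fun s => X s ω) (Ici 0))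
    (hφ0 : ∀ l : ℝ, 0 ≤ l → 0 ≤ φ l)
    (hφ : ∀ t l : ℝ, 0 ≤ t → 0 ≤ l →
      (∫ ω, Real.exp (-(l * X t ω)) ∂P) = Real.exp (-(t * φ l)))
    {α β q h : ℝ} (hα : 0 < α) (hβ : 0 ≤ β) (hq : 0 < q) (hqβ : q ≠ β) (hh : 0 < h) :
    ∫ p, ∑' k, gridTerm X α β q h k p ∂((volume.restrict (Ioi (0 : ℝ))).prod P) =
      Real.exp (-(α * h)) / (β - q) * (Real.exp (-(h * φ q)) - Real.exp (-(h * φ β))) *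
        (1 - Real.exp (-(h * (α + φ q))))⁻¹ := by
  have hr : Real.exp (-(h * (α + φ q))) < 1 := by
    have := hφ0 q hq.le
    rw [Real.exp_lt_one_iff, neg_lt_zero]
    positivity
  have hterm := hX.integral_gridTerm hmono hφ α hβ hq hqβ hh.le
  have hgeom := hasSum_geometric_of_lt_one (Real.exp_pos _).le hr
  rw [← integral_tsum_of_summable_integral_norm (hX.integrable_gridTerm α hβ hq hh.le)]
  · simp_rw [hterm]
    rw [tsum_mul_left, hgeom.tsum_eq]
  · simp_rw [Real.norm_of_nonneg (gridTerm_nonneg ..), hterm]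
    exact hgeom.summable.mul_left _

end Levy

/-- Limit of the grid formula as the mesh tends to `0`. -/
lemma tendsto_grid_formula (α c d e : ℝ) {f : ℝ} (hf : f ≠ 0) :
    Tendsto (fun h => Real.exp (-(α * h)) / e * (Real.exp (-(h * c)) - Real.exp (-(h * d))) *
      (1 - Real.exp (-(h * f)))⁻¹) (nhdsWithin 0 {0}ᶜ) (nhds ((d - c) / (e * f))) := by
  have hslope : ∀ c : ℝ, Tendsto (fun h => h⁻¹ * (1 - Real.exp (-(h * c)))) (nhdsWithin 0 {0}ᶜ)
      (nhds c) := by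
    intro c
    have hd : HasDerivAt (fun h : ℝ => 1 - Real.exp (-(h * c))) c 0 := by
      simpa using (((hasDerivAt_id (0 : ℝ)).mul_const c).neg.exp).const_sub 1
    simpa using hd.tendsto_slope_zero
  have hexp : Tendsto (fun h => Real.exp (-(α * h)) / e) (nhdsWithin 0 {0}ᶜ) (nhds (1 / e)) := by
    have : ContinuousAt (fun h => Real.exp (-(α * h)) / e) 0 := by fun_prop
    simpa using this.tendsto.mono_left nhdsWithin_le_nhds
  have hlim := (hexp.mul ((hslope d).sub (hslope c))).mul ((hslope f).inv₀ hf)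
  rw [show (d - c) / (e * f) = 1 / e * (d - c) * f⁻¹ by rw [div_eq_mul_inv, mul_inv]; ring]
  refine hlim.congr' (eventually_mem_nhdsWithin.mono fun h hh => ?_)
  have hh' : h ≠ 0 := hh
  rw [mul_inv, inv_inv, ← mul_sub]
  calc _ = (h⁻¹ * h) * (Real.exp (-(α * h)) / e *
        (Real.exp (-(h * c)) - Real.exp (-(h * d))) * (1 - Real.exp (-(h * f)))⁻¹) := by ring
    _ = _ := by rw [inv_mul_cancel₀ hh', one_mul]

theorem stmt6 [m0 : MeasurableSpace Ω] (P : Measure Ω) (ℱ : Filtration ℝ m0)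
    (X : ℝ → Ω → ℝ) (hX : IsLevy P ℱ X)
    (hmono : ∀ ω, MonotoneOn (fun s => X s ω) (Set.Ici 0))
    (φ : ℝ → ℝ) (hφ0 : ∀ l : ℝ, 0 ≤ l → 0 ≤ φ l)
    (hφ : ∀ t l : ℝ, 0 ≤ t → 0 ≤ l →
      (∫ ω, Real.exp (-(l * X t ω)) ∂P) = Real.exp (-(t * φ l)))
    (α β q : ℝ) (hα : 0 < α) (hβ : 0 ≤ β) (hq : 0 < q) (hqβ : q ≠ β) :
    (∫ x in Set.Ioi (0 : ℝ), Real.exp (-(q * x)) *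
        (∫ ω, (if hitsAbove X x ω then
          Real.exp (-(α * tauAbove X x ω) - β * (X (tauAbove X x ω) ω - x)) else 0) ∂P)) =
      (φ q - φ β) / ((q - β) * (α + φ q)) := by
  have := hX.isProb
  set μ := (volume.restrict (Ioi (0 : ℝ))).prod P with hμ
  have hstart : ∀ᵐ p ∂μ, X 0 p.2 ≤ p.1 := by
    have h1 : ∀ᵐ p ∂μ, X 0 p.2 = 0 := Measure.quasiMeasurePreserving_snd.ae hX.zero
    have h2 : ∀ᵐ p ∂μ, p.1 ∈ Ioi (0 : ℝ) :=
      Measure.quasiMeasurePreserving_fst.ae (ae_restrict_mem measurableSet_Ioi)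
    filter_upwards [h1, h2] with p hp1 hp2
    rw [hp1]
    exact le_of_lt hp2
  have hpos : ∀ n : ℕ, (0 : ℝ) < 1 / ((n : ℝ) + 1) := fun n => by positivity
  have hmesh := tendsto_one_div_add_atTop_nhds_zero_nat (𝕜 := ℝ)
  have hmeas : ∀ n : ℕ, AEStronglyMeasurable
      (fun p => ∑' k, gridTerm X α β q (1 / ((n : ℝ) + 1)) k p) μ := fun n =>
    (Measurable.tsum fun k =>
      measurable_gridTerm (fun t => hX.measurable) α β q (hpos n).le k).aestronglyMeasurable
  have hbound : ∀ n : ℕ, ∀ᵐ p ∂μ,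
      ‖∑' k, gridTerm X α β q (1 / ((n : ℝ) + 1)) k p‖ ≤ Real.exp (-(q * p.1)) := fun n =>
    hstart.mono fun p hp => norm_tsum_gridTerm_le (hmono p.2) hα.le hβ (hpos n) hp
  have hptw : ∀ᵐ p ∂μ, Tendsto (fun n : ℕ => ∑' k, gridTerm X α β q (1 / ((n : ℝ) + 1)) k p)
      atTop (nhds (passagePayoff X α β q p)) :=
    hstart.mono fun p hp =>
      tendsto_tsum_gridTerm (hmono p.2) (hX.rightCont p.2) α β q hp hpos hmesh
  have hdom : Integrable (fun p : ℝ × Ω => Real.exp (-(q * p.1))) μ := integrable_exp_neg_fst hq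
  have hpay : Integrable (passagePayoff X α β q) μ := by
    refine hdom.mono' (aestronglyMeasurable_of_tendsto_ae atTop hmeas hptw) ?_
    filter_upwards [ae_all_iff.mpr hbound, hptw] with p hp1 hp2
    exact le_of_tendsto' hp2.norm hp1
  have hlim := tendsto_integral_of_dominated_convergence _ hmeas hdom hbound hptw
  have hval : ∀ n : ℕ, _ = _ := fun n =>
    hX.integral_tsum_gridTerm hmono hφ0 hφ hα hβ hq hqβ (hpos n)
  simp_rw [hμ, hval] at hlim
  have hform := (tendsto_grid_formula α (φ q) (φ β) (β - q) (f := α + φ q)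
    (by linarith [hφ0 q hq.le])).comp
    (tendsto_nhdsWithin_iff.mpr ⟨hmesh, Eventually.of_forall fun n => (hpos n).ne'⟩)
  calc _ = ∫ x in Ioi (0 : ℝ), ∫ ω, passagePayoff X α β q (x, ω) ∂P := by
        simp only [passagePayoff, integral_const_mul]
    _ = ∫ p, passagePayoff X α β q p ∂μ := (integral_prod _ hpay).symm
    _ = (φ β - φ q) / ((β - q) * (α + φ q)) := tendsto_nhds_unique hlim hform
    _ = _ := by rw [← neg_sub (φ q), ← neg_sub q, neg_mul, neg_div_neg_eq]

end AKLevy
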